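/- Let Z ~ SN_d(ξ, Ω, α) with density f(z) = 2 φ_d(z − ξ; Ω) Φ(αᵀω⁻¹(z − ξ)). Then f has a unique mode (global maximizer, which is also the unique critical point), given by M₀ = ξ + (m₀*/α*) ω Ω̄ α = ξ + (m₀*/δ*) ω δ, where α* = (αᵀΩ̄α)^{1/2}, δ = Ω̄α/(1+αᵀΩ̄α)^{1/2}, δ* = (δᵀΩ̄⁻¹δ)^{1/2}, and m₀* is the unique mode of the univariate skew-normal density 2 φ(x) Φ(α* x) on ℝ. (When α = 0 the mode is M₀ = ξ.) -/

import Mathlib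

open MeasureTheory ProbabilityTheory Matrix

noncomputable section

/-- Standard normal density. -/
def stdNormalPDF (x : ℝ) : ℝ := (Real.sqrt (2 * Real.pi))⁻¹ * Real.exp (-x ^ 2 / 2)

/-- Standard normal cumulative distribution function `Φ`. -/
def stdNormalCDF (x : ℝ) : ℝ := ∫ t in Set.Iic x, stdNormalPDF t

/-- Density `φ_d(x; Ω)` of the centered multivariate normal `N_d(0, Ω)`. -/
def mvnPDF {d : ℕ} (Ωm : Matrix (Fin d) (Fin d) ℝ) (x : Fin d → ℝ) : ℝ :=
  (2 * Real.pi) ^ (-(d : ℝ) / 2) * Ωm.det ^ (-(1 : ℝ) / 2) *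
    Real.exp (-(x ⬝ᵥ (Ωm⁻¹ *ᵥ x)) / 2)

/-- The diagonal matrix `ω` of scale parameters, `ω_ii = √(Ω_ii)`. -/
def scaleMat {d : ℕ} (Ωm : Matrix (Fin d) (Fin d) ℝ) : Matrix (Fin d) (Fin d) ℝ :=
  Matrix.diagonal fun i => Real.sqrt (Ωm i i)

/-- The correlation matrix `Ω̄ = ω⁻¹ Ω ω⁻¹`. -/
def corrMat {d : ℕ} (Ωm : Matrix (Fin d) (Fin d) ℝ) : Matrix (Fin d) (Fin d) ℝ :=
  (scaleMat Ωm)⁻¹ * Ωm * (scaleMat Ωm)⁻¹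

/-- Density of the multivariate skew-normal distribution `SN_d(ξ, Ω, α)`. -/
def snPDF {d : ℕ} (ξ : Fin d → ℝ) (Ωm : Matrix (Fin d) (Fin d) ℝ) (α : Fin d → ℝ)
    (z : Fin d → ℝ) : ℝ :=
  2 * mvnPDF Ωm (z - ξ) * stdNormalCDF (α ⬝ᵥ ((scaleMat Ωm)⁻¹ *ᵥ (z - ξ)))

/-- `Z ~ SN_d(ξ, Ω, α)`. -/
def IsSN {Ω' : Type*} [MeasurableSpace Ω'] (P : Measure Ω') {d : ℕ}
    (Z : Ω' → Fin d → ℝ) (ξ : Fin d → ℝ) (Ωm : Matrix (Fin d) (Fin d) ℝ)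
    (α : Fin d → ℝ) : Prop :=
  Measure.map Z P = volume.withDensity fun z => ENNReal.ofReal (snPDF ξ Ωm α z)

/-- Density of the univariate skew-normal distribution `SN₁(0,1,α)`. -/
def sn1PDF (α x : ℝ) : ℝ := 2 * stdNormalPDF x * stdNormalCDF (α * x)

/-- The vector `δ = Ω̄α / (1 + αᵀΩ̄α)^{1/2}`. -/
def deltaOf {d : ℕ} (Ωb : Matrix (Fin d) (Fin d) ℝ) (α : Fin d → ℝ) : Fin d → ℝ :=
  (Real.sqrt (1 + α ⬝ᵥ (Ωb *ᵥ α)))⁻¹ • (Ωb *ᵥ α)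

lemma stdNormalPDF_pos (x : ℝ) : 0 < stdNormalPDF x := by
  unfold stdNormalPDF
  positivity

lemma continuous_stdNormalPDF : Continuous stdNormalPDF := by
  unfold stdNormalPDF
  fun_prop

lemma integrable_stdNormalPDF : Integrable stdNormalPDF := by
  have h := (integrable_exp_neg_mul_sq (b := 1 / 2) (by norm_num)).const_mul
    (Real.sqrt (2 * Real.pi))⁻¹
  refine h.congr (Filter.Eventually.of_forall fun x => ?_)
  simp only [stdNormalPDF]
  congr 2
  ring

lemma stdNormalCDF_pos (x : ℝ) : 0 < stdNormalCDF x := by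
  have hs : Function.support stdNormalPDF = Set.univ :=
    Set.eq_univ_of_forall fun t => (stdNormalPDF_pos t).ne'
  unfold stdNormalCDF
  rw [setIntegral_pos_iff_support_of_nonneg_ae
    (Filter.Eventually.of_forall fun t => (stdNormalPDF_pos t).le)
    integrable_stdNormalPDF.integrableOn, hs, Set.univ_inter]
  simp

lemma hasDerivAt_stdNormalCDF (x : ℝ) : HasDerivAt stdNormalCDF (stdNormalPDF x) x := by
  have h : stdNormalCDF = fun y => stdNormalCDF 0 + ∫ t in (0 : ℝ)..y, stdNormalPDF t := by
    funext y
    rw [← intervalIntegral.integral_Iic_sub_Iic integrable_stdNormalPDF.integrableOn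
      integrable_stdNormalPDF.integrableOn]
    simp [stdNormalCDF]
  rw [h]
  exact (continuous_stdNormalPDF.integral_hasStrictDerivAt 0 x).hasDerivAt.const_add _

lemma stdNormalCDF_add (u h : ℝ) :
    stdNormalCDF (u + h) = ∫ t in Set.Iic u, stdNormalPDF (t + h) := by
  have := (measurePreserving_add_right volume h).setIntegral_preimage_emb
    (measurableEmbedding_addRight h) stdNormalPDF (Set.Iic (u + h))
  rw [stdNormalCDF, ← this]
  simp

/-- The inverse Mills ratio `φ / Φ`. -/
def millsRatio (x : ℝ) : ℝ := stdNormalPDF x / stdNormalCDF x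

lemma millsRatio_pos (x : ℝ) : 0 < millsRatio x :=
  div_pos (stdNormalPDF_pos x) (stdNormalCDF_pos x)

lemma continuous_millsRatio : Continuous millsRatio := by
  refine continuous_stdNormalPDF.div ?_ fun x => (stdNormalCDF_pos x).ne'
  exact continuous_iff_continuousAt.2 fun x => (hasDerivAt_stdNormalCDF x).continuousAt

lemma stdNormalPDF_mul_le {t u h : ℝ} (htu : t ≤ u) (hh : 0 ≤ h) :
    stdNormalPDF (u + h) * stdNormalPDF t ≤ stdNormalPDF u * stdNormalPDF (t + h) := by
  unfold stdNormalPDF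
  rw [mul_mul_mul_comm, ← Real.exp_add, mul_mul_mul_comm _ _ _ (Real.exp (-(t + h) ^ 2 / 2)),
    ← Real.exp_add]
  refine mul_le_mul_of_nonneg_left (Real.exp_le_exp.2 ?_) (by positivity)
  nlinarith [mul_nonneg (sub_nonneg.2 htu) hh]

lemma antitone_millsRatio : Antitone millsRatio := by
  intro u v huv
  obtain ⟨h, hh, rfl⟩ : ∃ h, 0 ≤ h ∧ v = u + h := ⟨v - u, sub_nonneg.2 huv, by ring⟩
  unfold millsRatio
  rw [div_le_div_iff₀ (stdNormalCDF_pos _) (stdNormalCDF_pos _), stdNormalCDF_add u h,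
    stdNormalCDF, ← integral_const_mul, ← integral_const_mul]
  refine setIntegral_mono_on (integrable_stdNormalPDF.const_mul _).integrableOn
    ((integrable_stdNormalPDF.comp_add_right h).const_mul _).integrableOn measurableSet_Iic ?_
  exact fun t ht => stdNormalPDF_mul_le ht hh

lemma hasDerivAt_log_stdNormalCDF (x : ℝ) :
    HasDerivAt (fun y => Real.log (stdNormalCDF y)) (millsRatio x) x :=
  (hasDerivAt_stdNormalCDF x).log (stdNormalCDF_pos x).ne'

lemma concaveOn_log_stdNormalCDF :
    ConcaveOn ℝ Set.univ fun y => Real.log (stdNormalCDF y) := by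
  refine Antitone.concaveOn_univ_of_deriv
    (fun x => (hasDerivAt_log_stdNormalCDF x).differentiableAt) ?_
  rw [show deriv (fun y => Real.log (stdNormalCDF y)) = millsRatio from
    funext fun x => (hasDerivAt_log_stdNormalCDF x).deriv]
  exact antitone_millsRatio

lemma stdNormalCDF_le_tangent (u v : ℝ) :
    stdNormalCDF v ≤ stdNormalCDF u * Real.exp (millsRatio u * (v - u)) := by
  have key : Real.log (stdNormalCDF v) ≤ Real.log (stdNormalCDF u) + millsRatio u * (v - u) := by
    rcases lt_trichotomy u v with h | rfl | h
    · have := concaveOn_log_stdNormalCDF.slope_le_of_hasDerivAt (Set.mem_univ _)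
        (Set.mem_univ _) h (hasDerivAt_log_stdNormalCDF u)
      rw [slope_def_field, div_le_iff₀ (sub_pos.2 h)] at this
      linarith
    · simp
    · have := concaveOn_log_stdNormalCDF.le_slope_of_hasDerivAt (Set.mem_univ _)
        (Set.mem_univ _) h (hasDerivAt_log_stdNormalCDF u)
      rw [slope_def_field, le_div_iff₀ (sub_pos.2 h)] at this
      linarith
  have := Real.exp_le_exp.2 key
  rwa [Real.exp_add, Real.exp_log (stdNormalCDF_pos _), Real.exp_log (stdNormalCDF_pos _)] at this

lemma exists_eq_millsRatio {c : ℝ} (hc : 0 ≤ c) : ∃ r, r = millsRatio (c * r) := by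
  have hcont : Continuous fun r => r - millsRatio (c * r) :=
    continuous_id.sub (continuous_millsRatio.comp (by fun_prop))
  have h0 : (0 : ℝ) ≤ millsRatio 0 := (millsRatio_pos 0).le
  have hle : millsRatio (c * millsRatio 0) ≤ millsRatio 0 :=
    antitone_millsRatio (mul_nonneg hc h0)
  obtain ⟨r, -, hr⟩ := intermediate_value_Icc h0 hcont.continuousOn
    (show (0 : ℝ) ∈ Set.Icc _ _ from ⟨by simpa using h0, by simpa using hle⟩)
  exact ⟨r, sub_eq_zero.1 hr⟩

lemma sn1PDF_lt {s r : ℝ} (hr : r = millsRatio (s ^ 2 * r)) {x : ℝ} (hx : x ≠ r * s) :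
    sn1PDF s x < sn1PDF s (r * s) := by
  have ht := stdNormalCDF_le_tangent (s * (r * s)) (s * x)
  rw [show s * (r * s) = s ^ 2 * r by ring, ← hr] at ht
  have hpos := sq_pos_of_ne_zero (sub_ne_zero.2 hx)
  unfold sn1PDF
  rw [show s * (r * s) = s ^ 2 * r by ring]
  calc 2 * stdNormalPDF x * stdNormalCDF (s * x)
      ≤ 2 * stdNormalPDF x * (stdNormalCDF (s ^ 2 * r) * Real.exp (r * (s * x - s ^ 2 * r))) := by
        have := stdNormalPDF_pos x
        gcongr
    _ = 2 * ((Real.sqrt (2 * Real.pi))⁻¹ *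
          Real.exp (-x ^ 2 / 2 + r * (s * x - s ^ 2 * r))) * stdNormalCDF (s ^ 2 * r) := by
        rw [Real.exp_add, stdNormalPDF]
        ring
    _ < 2 * stdNormalPDF (r * s) * stdNormalCDF (s ^ 2 * r) := by
        have := stdNormalCDF_pos (s ^ 2 * r)
        unfold stdNormalPDF
        gcongr
        nlinarith

section Kernel

variable {n : Type*} [Fintype n]

/-- The skew-normal density with precision matrix `P`, centred and up to a constant factor. -/
def skewKernel (P : Matrix n n ℝ) (a x : n → ℝ) : ℝ :=
  Real.exp (-(x ⬝ᵥ (P *ᵥ x)) / 2) * stdNormalCDF (a ⬝ᵥ x)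

lemma dotProduct_mulVec_comm_of_isHermitian {P : Matrix n n ℝ} (hP : P.IsHermitian)
    (x y : n → ℝ) : x ⬝ᵥ (P *ᵥ y) = y ⬝ᵥ (P *ᵥ x) := by
  have hT : Pᵀ = P := by simpa [IsHermitian, conjTranspose_eq_transpose_of_trivial] using hP
  rw [dotProduct_mulVec, ← mulVec_transpose, hT, dotProduct_comm]

lemma skewKernel_lt {P : Matrix n n ℝ} (hP : P.PosDef) {a x₀ : n → ℝ}
    (h₀ : P *ᵥ x₀ = millsRatio (a ⬝ᵥ x₀) • a) {x : n → ℝ} (hx : x ≠ x₀) :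
    skewKernel P a x < skewKernel P a x₀ := by
  have hpos : 0 < (x - x₀) ⬝ᵥ (P *ᵥ (x - x₀)) := by
    simpa using hP.dotProduct_mulVec_pos (sub_ne_zero.2 hx)
  have hc := dotProduct_mulVec_comm_of_isHermitian hP.1 x x₀
  have h1 : x ⬝ᵥ (P *ᵥ x₀) = millsRatio (a ⬝ᵥ x₀) * (a ⬝ᵥ x) := by
    rw [h₀, dotProduct_smul, smul_eq_mul, dotProduct_comm x]
  have h2 : x₀ ⬝ᵥ (P *ᵥ x₀) = millsRatio (a ⬝ᵥ x₀) * (a ⬝ᵥ x₀) := by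
    rw [h₀, dotProduct_smul, smul_eq_mul, dotProduct_comm x₀]
  rw [mulVec_sub, dotProduct_sub, sub_dotProduct, sub_dotProduct] at hpos
  unfold skewKernel
  calc Real.exp (-(x ⬝ᵥ (P *ᵥ x)) / 2) * stdNormalCDF (a ⬝ᵥ x)
      ≤ Real.exp (-(x ⬝ᵥ (P *ᵥ x)) / 2) * (stdNormalCDF (a ⬝ᵥ x₀) *
          Real.exp (millsRatio (a ⬝ᵥ x₀) * (a ⬝ᵥ x - a ⬝ᵥ x₀))) := by
        gcongr
        exact stdNormalCDF_le_tangent _ _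
    _ = Real.exp (-(x ⬝ᵥ (P *ᵥ x)) / 2 + millsRatio (a ⬝ᵥ x₀) * (a ⬝ᵥ x - a ⬝ᵥ x₀)) *
          stdNormalCDF (a ⬝ᵥ x₀) := by
        rw [Real.exp_add]
        ring
    _ < _ := by
        have := stdNormalCDF_pos (a ⬝ᵥ x₀)
        gcongr
        linarith

lemma differentiable_skewKernel (P : Matrix n n ℝ) (a : n → ℝ) :
    Differentiable ℝ (skewKernel P a) := by
  have hΦ : Differentiable ℝ stdNormalCDF := fun x => (hasDerivAt_stdNormalCDF x).differentiableAt
  have hl : Differentiable ℝ fun x : n → ℝ => a ⬝ᵥ x := by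
    unfold dotProduct
    fun_prop
  have hq : Differentiable ℝ fun x : n → ℝ => x ⬝ᵥ (P *ᵥ x) := by
    unfold mulVec dotProduct
    fun_prop
  have hc : Differentiable ℝ fun x : n → ℝ => stdNormalCDF (a ⬝ᵥ x) := hΦ.fun_comp hl
  unfold skewKernel
  fun_prop

lemma hasDerivAt_skewKernel_line {P : Matrix n n ℝ} (hP : P.IsHermitian) (a x v : n → ℝ) :
    HasDerivAt (fun t : ℝ => skewKernel P a (x + t • v))
      (Real.exp (-(x ⬝ᵥ (P *ᵥ x)) / 2) *
        (stdNormalPDF (a ⬝ᵥ x) * (a ⬝ᵥ v) - stdNormalCDF (a ⬝ᵥ x) * (v ⬝ᵥ (P *ᵥ x)))) 0 := by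
  have hc := dotProduct_mulVec_comm_of_isHermitian hP x v
  have he : (fun t : ℝ => skewKernel P a (x + t • v)) = fun t =>
      Real.exp (-(x ⬝ᵥ (P *ᵥ x) + t * (2 * (v ⬝ᵥ (P *ᵥ x))) + t ^ 2 * (v ⬝ᵥ (P *ᵥ v))) / 2) *
        stdNormalCDF (a ⬝ᵥ x + t * (a ⬝ᵥ v)) := by
    funext t
    simp only [skewKernel, mulVec_add, mulVec_smul, dotProduct_add, add_dotProduct,
      dotProduct_smul, smul_dotProduct, smul_eq_mul, hc]
    ring_nf
  rw [he]
  have hid := hasDerivAt_id (0 : ℝ)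
  have hq : HasDerivAt (fun t : ℝ =>
      -(x ⬝ᵥ (P *ᵥ x) + t * (2 * (v ⬝ᵥ (P *ᵥ x))) + t ^ 2 * (v ⬝ᵥ (P *ᵥ v))) / 2)
      (-(v ⬝ᵥ (P *ᵥ x))) 0 := by
    refine ((((hid.mul_const (2 * (v ⬝ᵥ (P *ᵥ x)))).const_add (x ⬝ᵥ (P *ᵥ x))).add
      ((hid.pow 2).mul_const (v ⬝ᵥ (P *ᵥ v)))).neg.div_const 2).congr_deriv ?_
    simp
    ring
  have hl : HasDerivAt (fun t : ℝ => a ⬝ᵥ x + t * (a ⬝ᵥ v)) (a ⬝ᵥ v) 0 := by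
    simpa using (hid.mul_const (a ⬝ᵥ v)).const_add (a ⬝ᵥ x)
  have hΦ : HasDerivAt (fun t : ℝ => stdNormalCDF (a ⬝ᵥ x + t * (a ⬝ᵥ v)))
      (stdNormalPDF (a ⬝ᵥ x) * (a ⬝ᵥ v)) 0 :=
    HasDerivAt.comp (h₂ := stdNormalCDF) (0 : ℝ) (by simpa using hasDerivAt_stdNormalCDF (a ⬝ᵥ x)) hl
  refine (hq.exp.mul hΦ).congr_deriv ?_
  simp only [zero_mul, add_zero, ne_eq, OfNat.ofNat_ne_zero, not_false_eq_true, zero_pow]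
  ring

lemma mulVec_eq_of_fderiv_skewKernel_eq_zero {P : Matrix n n ℝ} (hP : P.IsHermitian)
    {a x : n → ℝ} (hx : fderiv ℝ (skewKernel P a) x = 0) :
    P *ᵥ x = millsRatio (a ⬝ᵥ x) • a := by
  have hline (v : n → ℝ) :
      stdNormalPDF (a ⬝ᵥ x) * (a ⬝ᵥ v) = stdNormalCDF (a ⬝ᵥ x) * (v ⬝ᵥ (P *ᵥ x)) := by
    have h1 := (differentiable_skewKernel P a x).lineDeriv_eq_fderiv (v := v)
    rw [hx, lineDeriv, (hasDerivAt_skewKernel_line hP a x v).deriv] at h1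
    simpa [Real.exp_ne_zero, sub_eq_zero] using h1
  refine dotProduct_eq _ _ fun v => ?_
  rw [smul_dotProduct, smul_eq_mul, millsRatio, div_mul_eq_mul_div, hline, dotProduct_comm,
    mul_div_cancel_left₀ _ (stdNormalCDF_pos _).ne']

lemma fderiv_skewKernel_eq_zero_iff {P : Matrix n n ℝ} (hP : P.PosDef) {a x₀ : n → ℝ}
    (h₀ : P *ᵥ x₀ = millsRatio (a ⬝ᵥ x₀) • a) (x : n → ℝ) :
    fderiv ℝ (skewKernel P a) x = 0 ↔ x = x₀ := by
  constructor
  · intro hx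
    by_contra hne
    exact lt_asymm (skewKernel_lt hP h₀ hne)
      (skewKernel_lt hP (mulVec_eq_of_fderiv_skewKernel_eq_zero hP.1 hx) (Ne.symm hne))
  · rintro rfl
    refine IsLocalMax.fderiv_eq_zero (Filter.Eventually.of_forall fun y => ?_)
    by_cases hy : y = x
    · rw [hy]
    · exact (skewKernel_lt hP h₀ hy).le

end Kernel

lemma inv_scaleMat {d : ℕ} {Ωm : Matrix (Fin d) (Fin d) ℝ} (hΩ : Ωm.PosDef) :
    (scaleMat Ωm)⁻¹ = diagonal fun i => (Real.sqrt (Ωm i i))⁻¹ := by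
  refine inv_eq_right_inv ?_
  rw [scaleMat, diagonal_mul_diagonal, ← diagonal_one]
  congr 1
  funext i
  exact mul_inv_cancel₀ (Real.sqrt_pos.2 hΩ.diag_pos).ne'

lemma isUnit_det_scaleMat {d : ℕ} {Ωm : Matrix (Fin d) (Fin d) ℝ} (hΩ : Ωm.PosDef) :
    IsUnit (scaleMat Ωm).det := by
  rw [scaleMat, det_diagonal, isUnit_iff_ne_zero, Finset.prod_ne_zero_iff]
  exact fun i _ => (Real.sqrt_pos.2 hΩ.diag_pos).ne'

lemma dotProduct_inv_scaleMat_mulVec {d : ℕ} {Ωm : Matrix (Fin d) (Fin d) ℝ} (hΩ : Ωm.PosDef)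
    (α x : Fin d → ℝ) :
    α ⬝ᵥ ((scaleMat Ωm)⁻¹ *ᵥ x) = ((scaleMat Ωm)⁻¹ *ᵥ α) ⬝ᵥ x := by
  rw [inv_scaleMat hΩ, dotProduct_mulVec, ← mulVec_transpose, diagonal_transpose]

lemma snPDF_eq_skewKernel {d : ℕ} (ξ α : Fin d → ℝ) {Ωm : Matrix (Fin d) (Fin d) ℝ}
    (hΩ : Ωm.PosDef) : ∃ C : ℝ, 0 < C ∧ snPDF ξ Ωm α =
      fun z => C * skewKernel Ωm⁻¹ ((scaleMat Ωm)⁻¹ *ᵥ α) (z - ξ) := by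
  refine ⟨2 * ((2 * Real.pi) ^ (-(d : ℝ) / 2) * Ωm.det ^ (-(1 : ℝ) / 2)), ?_, ?_⟩
  · have := hΩ.det_pos
    positivity
  · funext z
    rw [snPDF, mvnPDF, skewKernel, dotProduct_inv_scaleMat_mulVec hΩ]
    ring

lemma scaleMat_mulVec_corrMat_mulVec {d : ℕ} {Ωm : Matrix (Fin d) (Fin d) ℝ} (hΩ : Ωm.PosDef)
    (α : Fin d → ℝ) :
    scaleMat Ωm *ᵥ (corrMat Ωm *ᵥ α) = Ωm *ᵥ ((scaleMat Ωm)⁻¹ *ᵥ α) := by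
  rw [mulVec_mulVec, mulVec_mulVec, corrMat, Matrix.mul_assoc,
    mul_nonsing_inv_cancel_left _ _ (isUnit_det_scaleMat hΩ)]

lemma dotProduct_corrMat_mulVec {d : ℕ} {Ωm : Matrix (Fin d) (Fin d) ℝ} (hΩ : Ωm.PosDef)
    (α : Fin d → ℝ) :
    α ⬝ᵥ (corrMat Ωm *ᵥ α) =
      ((scaleMat Ωm)⁻¹ *ᵥ α) ⬝ᵥ (Ωm *ᵥ ((scaleMat Ωm)⁻¹ *ᵥ α)) := by
  rw [← dotProduct_inv_scaleMat_mulVec hΩ, mulVec_mulVec, mulVec_mulVec, corrMat,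
    Matrix.mul_assoc]

lemma inv_scaleMat_mulVec_ne_zero {d : ℕ} {Ωm : Matrix (Fin d) (Fin d) ℝ} (hΩ : Ωm.PosDef)
    {α : Fin d → ℝ} (hα : α ≠ 0) : (scaleMat Ωm)⁻¹ *ᵥ α ≠ 0 := by
  intro h
  apply hα
  have := congrArg (scaleMat Ωm *ᵥ ·) h
  simpa [mulVec_mulVec, mul_nonsing_inv _ (isUnit_det_scaleMat hΩ)] using this

lemma inv_corrMat_mulVec_corrMat_mulVec {d : ℕ} {Ωm : Matrix (Fin d) (Fin d) ℝ}
    (hΩ : Ωm.PosDef) (α : Fin d → ℝ) : (corrMat Ωm)⁻¹ *ᵥ (corrMat Ωm *ᵥ α) = α := by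
  have hu : IsUnit (corrMat Ωm).det := by
    have h := isUnit_nonsing_inv_det _ (isUnit_det_scaleMat hΩ)
    rw [corrMat, det_mul, det_mul]
    exact (h.mul hΩ.det_pos.ne'.isUnit).mul h
  rw [mulVec_mulVec, nonsing_inv_mul _ hu, one_mulVec]

lemma sqrt_deltaOf_corrMat {d : ℕ} {Ωm : Matrix (Fin d) (Fin d) ℝ} (hΩ : Ωm.PosDef)
    (α : Fin d → ℝ) :
    Real.sqrt (deltaOf (corrMat Ωm) α ⬝ᵥ ((corrMat Ωm)⁻¹ *ᵥ deltaOf (corrMat Ωm) α)) =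
      (Real.sqrt (1 + α ⬝ᵥ (corrMat Ωm *ᵥ α)))⁻¹ * Real.sqrt (α ⬝ᵥ (corrMat Ωm *ᵥ α)) := by
  have h : 0 ≤ (Real.sqrt (1 + α ⬝ᵥ (corrMat Ωm *ᵥ α)))⁻¹ := by positivity
  rw [deltaOf, mulVec_smul, inv_corrMat_mulVec_corrMat_mulVec hΩ, smul_dotProduct,
    dotProduct_smul, smul_eq_mul, smul_eq_mul, ← mul_assoc, Real.sqrt_mul (mul_self_nonneg _),
    Real.sqrt_mul_self h, dotProduct_comm]

/-- the multivariate skew-normal density has a unique mode (global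
maximizer and unique critical point), lying at `ξ + (m₀*/α*) ω Ω̄ α = ξ + (m₀*/δ*) ω δ`,
where `m₀*` is the unique mode of the univariate `SN₁(0,1,α*)` density. -/
theorem skew_normal_unique_mode
    {d : ℕ} (ξ α : Fin d → ℝ) (Ωm : Matrix (Fin d) (Fin d) ℝ) (hΩ : Ωm.PosDef) :
    let αstar := Real.sqrt (α ⬝ᵥ (corrMat Ωm *ᵥ α))
    let δ := deltaOf (corrMat Ωm) α
    let δstar := Real.sqrt (δ ⬝ᵥ ((corrMat Ωm)⁻¹ *ᵥ δ))
    ∃ M0 : Fin d → ℝ,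
      -- M0 is the unique global maximizer of the density
      (∀ z : Fin d → ℝ, z ≠ M0 → snPDF ξ Ωm α z < snPDF ξ Ωm α M0) ∧
      -- M0 is the unique critical point of the density
      (∀ z : Fin d → ℝ, fderiv ℝ (snPDF ξ Ωm α) z = 0 ↔ z = M0) ∧
      -- when α = 0 the mode is ξ
      (α = 0 → M0 = ξ) ∧
      -- when α ≠ 0 the mode is ξ + (m₀*/α*) ω Ω̄ α = ξ + (m₀*/δ*) ω δ, with m₀* the
      -- unique mode of SN₁(0,1,α*)
      (α ≠ 0 → ∃ m0 : ℝ,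
        (∀ x : ℝ, x ≠ m0 → sn1PDF αstar x < sn1PDF αstar m0) ∧
        M0 = ξ + (m0 / αstar) • (scaleMat Ωm *ᵥ (corrMat Ωm *ᵥ α)) ∧
        M0 = ξ + (m0 / δstar) • (scaleMat Ωm *ᵥ δ)) := by
  intro αstar δ δstar
  obtain ⟨C, hC, hf⟩ := snPDF_eq_skewKernel ξ α hΩ
  set a := (scaleMat Ωm)⁻¹ *ᵥ α with ha
  have hq : α ⬝ᵥ (corrMat Ωm *ᵥ α) = a ⬝ᵥ (Ωm *ᵥ a) := dotProduct_corrMat_mulVec hΩ α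
  have hq0 : 0 ≤ a ⬝ᵥ (Ωm *ᵥ a) := by simpa using hΩ.posSemidef.dotProduct_mulVec_nonneg a
  obtain ⟨r, hr⟩ := exists_eq_millsRatio hq0
  have h₀ : Ωm⁻¹ *ᵥ (r • (Ωm *ᵥ a)) = millsRatio (a ⬝ᵥ (r • (Ωm *ᵥ a))) • a := by
    rw [dotProduct_smul, smul_eq_mul, mul_comm r, ← hr, mulVec_smul, mulVec_mulVec,
      nonsing_inv_mul _ hΩ.det_pos.ne'.isUnit, one_mulVec]
  refine ⟨ξ + r • (Ωm *ᵥ a), fun z hz => ?_, fun z => ?_, fun hα => ?_, fun hα => ?_⟩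
  · simp only [hf, add_sub_cancel_left]
    refine mul_lt_mul_of_pos_left (skewKernel_lt hΩ.inv h₀ fun h => hz ?_) hC
    rw [← h, add_sub_cancel]
  · rw [hf, fderiv_const_mul ((differentiableAt_comp_sub ξ).2
      (differentiable_skewKernel _ _ _)), fderiv_comp_sub, smul_eq_zero_iff_right hC.ne',
      fderiv_skewKernel_eq_zero_iff hΩ.inv h₀, sub_eq_iff_eq_add']
  · simp [ha, hα]
  · have hpos : 0 < a ⬝ᵥ (Ωm *ᵥ a) := by
      have ha0 : a ≠ 0 := inv_scaleMat_mulVec_ne_zero hΩ hα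
      simpa using hΩ.dotProduct_mulVec_pos ha0
    have hs : 0 < αstar := Real.sqrt_pos.2 (hq ▸ hpos)
    have hs2 : αstar ^ 2 = a ⬝ᵥ (Ωm *ᵥ a) := by rw [Real.sq_sqrt (hq ▸ hq0), hq]
    refine ⟨r * αstar, fun x hx => sn1PDF_lt (by rwa [hs2]) hx, ?_, ?_⟩
    · rw [scaleMat_mulVec_corrMat_mulVec hΩ, mul_div_cancel_right₀ _ hs.ne']
    · have hk : 0 < Real.sqrt (1 + α ⬝ᵥ (corrMat Ωm *ᵥ α)) := Real.sqrt_pos.2 (by linarith)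
      have hδ : δstar = (Real.sqrt (1 + α ⬝ᵥ (corrMat Ωm *ᵥ α)))⁻¹ * αstar :=
        sqrt_deltaOf_corrMat hΩ α
      have hcoef : r * αstar / δstar * (Real.sqrt (1 + α ⬝ᵥ (corrMat Ωm *ᵥ α)))⁻¹ = r := by
        rw [hδ]
        field_simp
      rw [show δ = deltaOf (corrMat Ωm) α from rfl, deltaOf, mulVec_smul,
        scaleMat_mulVec_corrMat_mulVec hΩ, smul_smul, hcoef]

end
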